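/- arXiv:0910.1947 — 2 statements merged into one kernel-verified Lean document; each statement's English description precedes it below -/
import Mathlib

section
/- Let (x_n) be a sequence in V_ρ(λ;p). If ρ(x_n) → 0 as n → ∞, then ‖x_n‖_L → 0 as n → ∞. -/
open Filter
open scoped BigOperators ENNReal

/-- The index window `I_k = {j ∈ ℤ : k - λ_k + 1 ≤ j ≤ k}` of the
de la Vallée-Poussin mean (indices are positive integers). -/
noncomputable def vpWindow (lam : ℕ → ℝ) (k : ℕ) : Finset ℕ :=
  (Finset.Icc 1 k).filter fun j => (k : ℝ) - lam k + 1 ≤ (j : ℝ)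

/-- The modular `ρ(x) = ∑_{k≥1} ((1/λ_k) ∑_{j ∈ I_k} |x_j|)^{p_k}`,
valued in `ℝ≥0∞` (so that `ρ(x) < ∞` is meaningful). -/
noncomputable def vpModular (lam pp : ℕ → ℝ) (x : ℕ → ℝ) : ℝ≥0∞ :=
  ∑' k : ℕ, ENNReal.ofReal
    (((lam (k + 1))⁻¹ * ∑ j ∈ vpWindow lam (k + 1), |x j|) ^ pp (k + 1))

/-- Membership in `V_ρ(λ;p) = {x : ρ(t x) < ∞ for some t > 0}`. -/
def memVrho (lam pp : ℕ → ℝ) (x : ℕ → ℝ) : Prop :=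
  ∃ t : ℝ, 0 < t ∧ vpModular lam pp (t • x) < ⊤

/-- The Luxemburg norm `‖x‖_L = inf {t > 0 : ρ(x/t) ≤ 1}`. -/
noncomputable def luxNorm (lam pp : ℕ → ℝ) (x : ℕ → ℝ) : ℝ :=
  sInf {t : ℝ | 0 < t ∧ vpModular lam pp (t⁻¹ • x) ≤ 1}

/-- Scaling by `c ≥ 1` enlarges the modular by a factor of at most `c ^ M` when the exponents are
bounded by `M`. -/
theorem vpModular_smul_le {lam pp : ℕ → ℝ} {M c : ℝ} (hlam : ∀ k : ℕ, 1 ≤ k → 0 ≤ lam k)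
    (hM : ∀ k : ℕ, pp (k + 1) ≤ M) (hc : 1 ≤ c) (x : ℕ → ℝ) :
    vpModular lam pp (c • x) ≤ ENNReal.ofReal (c ^ M) * vpModular lam pp x := by
  have hc0 : 0 ≤ c := zero_le_one.trans hc
  unfold vpModular
  rw [← ENNReal.tsum_mul_left]
  refine ENNReal.tsum_le_tsum fun k => ?_
  rw [← ENNReal.ofReal_mul (by positivity)]
  refine ENNReal.ofReal_le_ofReal ?_
  have hmean : 0 ≤ (lam (k + 1))⁻¹ * ∑ j ∈ vpWindow lam (k + 1), |x j| :=
    mul_nonneg (inv_nonneg.2 (hlam _ (by omega))) (Finset.sum_nonneg fun _ _ => abs_nonneg _)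
  have hscale : (lam (k + 1))⁻¹ * ∑ j ∈ vpWindow lam (k + 1), |(c • x) j| =
      c * ((lam (k + 1))⁻¹ * ∑ j ∈ vpWindow lam (k + 1), |x j|) := by
    simp only [Pi.smul_apply, smul_eq_mul, abs_mul, abs_of_nonneg hc0, ← Finset.mul_sum]
    ring
  rw [hscale, Real.mul_rpow hc0 hmean]
  exact mul_le_mul_of_nonneg_right (Real.rpow_le_rpow_of_exponent_le hc (hM k))
    (Real.rpow_nonneg hmean _)

theorem luxNorm_nonneg (lam pp x : ℕ → ℝ) : 0 ≤ luxNorm lam pp x :=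
  Real.sInf_nonneg fun _ ht => ht.1.le

theorem luxNorm_le {lam pp x : ℕ → ℝ} {t : ℝ} (ht : 0 < t)
    (h : vpModular lam pp (t⁻¹ • x) ≤ 1) : luxNorm lam pp x ≤ t :=
  csInf_le ⟨0, fun _ hs => hs.1.le⟩ ⟨ht, h⟩

/-- If `ρ(x_n) → 0`, then `‖x_n‖_L → 0`. -/
theorem luxNorm_tendsto_zero (lam pp : ℕ → ℝ)
    (hlam1 : lam 1 = 1)
    (hlam_pos : ∀ k : ℕ, 1 ≤ k → 0 < lam k)
    (hlam_mono : ∀ k : ℕ, 1 ≤ k → lam k ≤ lam (k + 1))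
    (hlam_step : ∀ k : ℕ, 1 ≤ k → lam (k + 1) ≤ lam k + 1)
    (hlam_top : Tendsto lam atTop atTop)
    (hp_gt : ∀ k : ℕ, 1 ≤ k → 1 < pp k)
    (hp_bdd : BddAbove (Set.range fun k : ℕ => pp (k + 1)))
    (xs : ℕ → ℕ → ℝ) (hxs : ∀ n, memVrho lam pp (xs n))
    (hmod : Tendsto (fun n => vpModular lam pp (xs n)) atTop (nhds 0)) :
    Tendsto (fun n => luxNorm lam pp (xs n)) atTop (nhds 0) := by
  obtain ⟨M, hM⟩ := hp_bdd
  have hM' : ∀ k : ℕ, pp (k + 1) ≤ M := fun k => hM ⟨k, rfl⟩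
  rw [tendsto_order]
  refine ⟨fun a ha => Eventually.of_forall fun n => ha.trans_le (luxNorm_nonneg _ _ _),
    fun ε hε => ?_⟩
  obtain ⟨t, ht, htm⟩ := exists_between (lt_min hε one_pos)
  obtain ⟨htε, ht1⟩ := lt_min_iff.1 htm
  have hlim : Tendsto (fun n => ENNReal.ofReal (t⁻¹ ^ M) * vpModular lam pp (xs n)) atTop
      (nhds 0) := by
    simpa using ENNReal.Tendsto.const_mul hmod (Or.inr ENNReal.ofReal_ne_top)
  filter_upwards [hlim.eventually_le_const one_pos] with n hn
  exact (luxNorm_le ht ((vpModular_smul_le (fun k hk => (hlam_pos k hk).le) hM'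
    ((one_le_inv₀ ht).2 ht1.le) (xs n)).trans hn)).trans_lt htε
end

section
/- Let x ∈ V_ρ(λ;p) and let (x_n) be a sequence in V_ρ(λ;p). If ρ(x_n) → ρ(x) as n → ∞ and x_n(j) → x(j) as n → ∞ for every coordinate j, then ‖x_n − x‖_L → 0 as n → ∞. -/
open Filter
open scoped BigOperators ENNReal

/-- The de la Vallée-Poussin mean `(1/λ_k) ∑_{j ∈ I_k} |x_j|`. -/
noncomputable def vpMean (lam : ℕ → ℝ) (x : ℕ → ℝ) (k : ℕ) : ℝ :=
  (lam k)⁻¹ * ∑ j ∈ vpWindow lam k, |x j|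

theorem vpModular_eq_tsum_vpMean (lam pp x : ℕ → ℝ) :
    vpModular lam pp x = ∑' k : ℕ, ENNReal.ofReal (vpMean lam x (k + 1) ^ pp (k + 1)) :=
  rfl

theorem vpMean_nonneg {lam : ℕ → ℝ} {k : ℕ} (hk : 0 ≤ lam k) (x : ℕ → ℝ) :
    0 ≤ vpMean lam x k :=
  mul_nonneg (inv_nonneg.2 hk) (Finset.sum_nonneg fun _ _ => abs_nonneg _)

theorem vpMean_smul (lam x : ℕ → ℝ) (k : ℕ) (c : ℝ) :
    vpMean lam (c • x) k = |c| * vpMean lam x k := by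
  simp only [vpMean, Pi.smul_apply, smul_eq_mul, abs_mul, ← Finset.mul_sum]
  ring

theorem vpMean_sub_le {lam : ℕ → ℝ} {k : ℕ} (hk : 0 ≤ lam k) (x y : ℕ → ℝ) :
    vpMean lam (x - y) k ≤ vpMean lam x k + vpMean lam y k := by
  rw [vpMean, vpMean, vpMean, ← mul_add, ← Finset.sum_add_distrib]
  exact mul_le_mul_of_nonneg_left (Finset.sum_le_sum fun j _ => abs_sub _ _)
    (inv_nonneg.2 hk)

theorem tendsto_vpMean {ι : Type*} {l : Filter ι} (lam : ℕ → ℝ) {x : ℕ → ℝ} {xs : ι → ℕ → ℝ}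
    (h : ∀ j : ℕ, 1 ≤ j → Tendsto (fun n => xs n j) l (nhds (x j))) (k : ℕ) :
    Tendsto (fun n => vpMean lam (xs n) k) l (nhds (vpMean lam x k)) := by
  refine (tendsto_finsetSum _ fun j hj => ?_).const_mul _
  have hj1 : 1 ≤ j := (Finset.mem_Icc.1 (Finset.mem_filter.1 hj).1).1
  exact (h j hj1).abs

theorem mul_rpow_le_max_one_rpow {c a p M : ℝ} (hc : 0 ≤ c) (ha : 0 ≤ a) (hp : 0 ≤ p)
    (hpM : p ≤ M) : (c * a) ^ p ≤ max 1 c ^ M * a ^ p := by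
  rw [Real.mul_rpow hc ha]
  refine mul_le_mul_of_nonneg_right ?_ (Real.rpow_nonneg ha p)
  exact (Real.rpow_le_rpow hc (le_max_right 1 c) hp).trans
    (Real.rpow_le_rpow_of_exponent_le (le_max_left 1 c) hpM)

theorem mul_rpow_le_of_le_add {c a b d p M : ℝ} (hc : 0 ≤ c) (ha : 0 ≤ a) (hb : 0 ≤ b)
    (hd : 0 ≤ d) (hdab : d ≤ a + b) (hp : 0 ≤ p) (hpM : p ≤ M) :
    (c * d) ^ p ≤ max 1 (2 * c) ^ M * (a ^ p + b ^ p) := by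
  have hm : 0 ≤ max a b := ha.trans (le_max_left a b)
  have hdm : c * d ≤ 2 * c * max a b := by
    nlinarith [le_max_left a b, le_max_right a b]
  refine (Real.rpow_le_rpow (mul_nonneg hc hd) hdm hp).trans <|
    (mul_rpow_le_max_one_rpow (by positivity) hm hp hpM).trans ?_
  refine mul_le_mul_of_nonneg_left ?_ (by positivity)
  have hap := Real.rpow_nonneg ha p
  have hbp := Real.rpow_nonneg hb p
  rcases max_choice a b with h | h <;> rw [h] <;> linarith

/-- The modular is finite on all of `V_ρ(λ;p)` when the exponents are bounded. -/
theorem vpModular_ne_top_of_memVrho {lam pp : ℕ → ℝ} {M : ℝ} (hlam : ∀ k, 0 ≤ lam (k + 1))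
    (hp : ∀ k, 0 ≤ pp (k + 1)) (hpM : ∀ k, pp (k + 1) ≤ M) {x : ℕ → ℝ}
    (hx : memVrho lam pp x) : vpModular lam pp x ≠ ⊤ := by
  obtain ⟨t, ht, htop⟩ := hx
  have hle : vpModular lam pp x
      ≤ ENNReal.ofReal (max 1 t⁻¹ ^ M) * vpModular lam pp (t • x) := by
    rw [vpModular_eq_tsum_vpMean, vpModular_eq_tsum_vpMean, ← ENNReal.tsum_mul_left]
    refine ENNReal.tsum_le_tsum fun k => ?_
    rw [← ENNReal.ofReal_mul (by positivity)]
    refine ENNReal.ofReal_le_ofReal ?_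
    have h := mul_rpow_le_max_one_rpow (inv_nonneg.2 ht.le)
      (vpMean_nonneg (hlam k) (t • x)) (hp k) (hpM k)
    rwa [vpMean_smul, abs_of_pos ht, inv_mul_cancel_left₀ ht.ne',
      ← abs_of_pos ht, ← vpMean_smul, abs_of_pos ht] at h
  exact (hle.trans_lt (ENNReal.mul_lt_top ENNReal.ofReal_lt_top htop)).ne

/-- Dominated convergence for series in `ℝ≥0∞`. -/
theorem ENNReal.tendsto_tsum_of_le_of_tendsto {f : ℕ → ℕ → ℝ≥0∞} {F g : ℕ → ℝ≥0∞}
    (hg : ∑' k, g k ≠ ⊤) (hfg : ∀ n k, f n k ≤ g k)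
    (hf : ∀ k, Tendsto (fun n => f n k) atTop (nhds (F k))) :
    Tendsto (fun n => ∑' k, f n k) atTop (nhds (∑' k, F k)) := by
  simp only [← MeasureTheory.lintegral_count] at hg ⊢
  exact MeasureTheory.tendsto_lintegral_of_dominated_convergence g
    (fun n => measurable_of_countable _) (fun n => Eventually.of_forall (hfg n)) hg
    (Eventually.of_forall hf)

/-- Scheffé's lemma for series in `ℝ≥0∞`, for the truncated differences. -/
theorem ENNReal.tendsto_tsum_sub_of_tendsto_tsum {f : ℕ → ℕ → ℝ≥0∞} {F : ℕ → ℝ≥0∞}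
    (hF : ∑' k, F k ≠ ⊤) (hf : ∀ k, Tendsto (fun n => f n k) atTop (nhds (F k)))
    (hsum : Tendsto (fun n => ∑' k, f n k) atTop (nhds (∑' k, F k))) :
    Tendsto (fun n => ∑' k, (f n k - F k)) atTop (nhds 0) := by
  have hlow : Tendsto (fun n => ∑' k, (F k - f n k)) atTop (nhds 0) := by
    have h := ENNReal.tendsto_tsum_of_le_of_tendsto (f := fun n k => F k - f n k)
      (F := fun k => F k - F k) hF (fun n k => tsub_le_self)
      (fun k => ENNReal.Tendsto.sub tendsto_const_nhds (hf k)
        (Or.inl (ENNReal.ne_top_of_tsum_ne_top hF k)))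
    simpa using h
  have heq : ∀ n, ∑' k, (f n k - F k)
      = ∑' k, f n k + ∑' k, (F k - f n k) - ∑' k, F k := by
    intro n
    refine ENNReal.eq_sub_of_add_eq hF ?_
    rw [← ENNReal.tsum_add, ← ENNReal.tsum_add]
    refine tsum_congr fun k => ?_
    rw [tsub_add_eq_max, add_comm, tsub_add_eq_max, max_comm]
  simp only [heq]
  have h := ENNReal.Tendsto.sub (hsum.add hlow) (tendsto_const_nhds (x := ∑' k, F k))
    (Or.inr hF)
  simpa using h

/-- Dominated convergence to zero with a convergent sequence of dominating series. -/
theorem ENNReal.tendsto_tsum_zero_of_le_mul_add {f g : ℕ → ℕ → ℝ≥0∞} {F : ℕ → ℝ≥0∞}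
    {C : ℝ≥0∞} (hC : C ≠ ⊤) (hF : ∑' k, F k ≠ ⊤)
    (hf : ∀ k, Tendsto (fun n => f n k) atTop (nhds (F k)))
    (hsum : Tendsto (fun n => ∑' k, f n k) atTop (nhds (∑' k, F k)))
    (hg : ∀ k, Tendsto (fun n => g n k) atTop (nhds 0))
    (hle : ∀ n k, g n k ≤ C * (f n k + F k)) :
    Tendsto (fun n => ∑' k, g n k) atTop (nhds 0) := by
  have hmin : Tendsto (fun n => ∑' k, min (g n k) (C * (F k + F k))) atTop (nhds 0) := by
    have h := ENNReal.tendsto_tsum_of_le_of_tendsto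
      (f := fun n k => min (g n k) (C * (F k + F k))) (F := fun k => 0)
      (g := fun k => C * (F k + F k))
      (by
        rw [ENNReal.tsum_mul_left, ENNReal.tsum_add]
        exact ENNReal.mul_ne_top hC (ENNReal.add_ne_top.2 ⟨hF, hF⟩))
      (fun n k => min_le_right _ _)
      (fun k => by simpa using (hg k).min (tendsto_const_nhds (x := C * (F k + F k))))
    simpa using h
  have hexc : Tendsto (fun n => C * ∑' k, (f n k - F k)) atTop (nhds 0) := by
    simpa using ENNReal.Tendsto.const_mul
      (ENNReal.tendsto_tsum_sub_of_tendsto_tsum hF hf hsum) (Or.inr hC)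
  refine tendsto_of_tendsto_of_tendsto_of_le_of_le tendsto_const_nhds
    (by simpa using hmin.add hexc) (fun n => zero_le) fun n => ?_
  simp only [← ENNReal.tsum_mul_left, ← ENNReal.tsum_add]
  refine ENNReal.tsum_le_tsum fun k => ?_
  rw [min_add, le_min_iff]
  refine ⟨le_self_add, (hle n k).trans ?_⟩
  rw [← mul_add]
  refine mul_le_mul' le_rfl ?_
  calc f n k + F k ≤ (f n k - F k + F k) + F k := by gcongr; exact le_tsub_add
    _ = F k + F k + (f n k - F k) := by ring

/-- If `ρ(x_n) → ρ(x)` and `x_n(j) → x(j)` for every coordinate `j`,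
then `‖x_n - x‖_L → 0`. -/
theorem luxNorm_tendsto_of_modular_and_coord (lam pp : ℕ → ℝ)
    (hlam1 : lam 1 = 1)
    (hlam_pos : ∀ k : ℕ, 1 ≤ k → 0 < lam k)
    (hlam_mono : ∀ k : ℕ, 1 ≤ k → lam k ≤ lam (k + 1))
    (hlam_step : ∀ k : ℕ, 1 ≤ k → lam (k + 1) ≤ lam k + 1)
    (hlam_top : Tendsto lam atTop atTop)
    (hp_gt : ∀ k : ℕ, 1 ≤ k → 1 < pp k)
    (hp_bdd : BddAbove (Set.range fun k : ℕ => pp (k + 1)))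
    (x : ℕ → ℝ) (hx : memVrho lam pp x)
    (xs : ℕ → ℕ → ℝ) (hxs : ∀ n, memVrho lam pp (xs n))
    (hmod : Tendsto (fun n => vpModular lam pp (xs n)) atTop
      (nhds (vpModular lam pp x)))
    (hcoord : ∀ j : ℕ, 1 ≤ j →
      Tendsto (fun n => xs n j) atTop (nhds (x j))) :
    Tendsto (fun n => luxNorm lam pp (xs n - x)) atTop (nhds 0) := by
  obtain ⟨M, hM⟩ := hp_bdd
  have hpM : ∀ k, pp (k + 1) ≤ M := fun k => hM ⟨k, rfl⟩
  have hp : ∀ k, 0 < pp (k + 1) := fun k => zero_lt_one.trans (hp_gt _ k.succ_pos)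
  have hlam : ∀ k, 0 ≤ lam (k + 1) := fun k => (hlam_pos _ k.succ_pos).le
  have hfin : vpModular lam pp x ≠ ⊤ :=
    vpModular_ne_top_of_memVrho hlam (fun k => (hp k).le) hpM hx
  have hmod_sub : ∀ c : ℝ, 0 < c →
      Tendsto (fun n => vpModular lam pp (c • (xs n - x))) atTop (nhds 0) := by
    intro c hc
    refine ENNReal.tendsto_tsum_zero_of_le_mul_add
      (C := ENNReal.ofReal (max 1 (2 * c) ^ M)) ENNReal.ofReal_ne_top hfin
      (fun k => ENNReal.tendsto_ofReal
        ((tendsto_vpMean lam hcoord (k + 1)).rpow_const (Or.inr (hp k).le)))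
      hmod (fun k => ?_) fun n k => ?_
    · have hsub : ∀ j : ℕ, 1 ≤ j →
          Tendsto (fun n => (c • (xs n - x)) j) atTop (nhds ((0 : ℕ → ℝ) j)) := by
        intro j hj
        simpa using ((hcoord j hj).sub_const (x j)).const_mul c
      have h := ENNReal.tendsto_ofReal
        ((tendsto_vpMean lam hsub (k + 1)).rpow_const (p := pp (k + 1)) (Or.inr (hp k).le))
      have h0 : vpMean lam 0 (k + 1) = 0 := by simp [vpMean]
      rwa [h0, Real.zero_rpow (hp k).ne', ENNReal.ofReal_zero] at h
    · have hx0 := vpMean_nonneg (hlam k) x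
      have hxs0 := vpMean_nonneg (hlam k) (xs n)
      change ENNReal.ofReal (vpMean lam (c • (xs n - x)) (k + 1) ^ pp (k + 1)) ≤
        _ * (ENNReal.ofReal (vpMean lam (xs n) (k + 1) ^ pp (k + 1)) +
          ENNReal.ofReal (vpMean lam x (k + 1) ^ pp (k + 1)))
      rw [← ENNReal.ofReal_add (by positivity) (by positivity),
        ← ENNReal.ofReal_mul (by positivity), vpMean_smul, abs_of_pos hc]
      exact ENNReal.ofReal_le_ofReal <| mul_rpow_le_of_le_add hc.le hxs0 hx0
        (vpMean_nonneg (hlam k) _) (vpMean_sub_le (hlam k) _ _) (hp k).le (hpM k)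
  refine tendsto_order.2 ⟨fun a ha => Eventually.of_forall fun n =>
    ha.trans_le (luxNorm_nonneg lam pp _), fun ε hε => ?_⟩
  filter_upwards [(hmod_sub (ε / 2)⁻¹ (by positivity)).eventually_le_const zero_lt_one]
    with n hn
  exact (luxNorm_le (half_pos hε) hn).trans_lt (half_lt_self hε)
end
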